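/- Let F_q be a finite field with q elements of characteristic p, let k be an integer with 2 ≤ k < p, let F ∈ F_q[x] be monic of degree n, and let h, ℓ be integers with 0 < h ≤ ℓ < n. Then the number of polynomials G ∈ I_q(F,h) such that P^k divides G for some irreducible polynomial P with deg P > ℓ is at most (n/(ℓ+1))·q^{(h+1)(1 − (k−1)/p)} + q^{(k−1)(h/p + 1)}. -/

import Mathlib

open Polynomial

theorem Nat.count_mod_lt_of_le {p m N : ℕ} (hN : N ≤ p) :
    Nat.count (fun e => e % p < m) N = min N m := by
  induction N with
  | zero => simp
  | succ N ih =>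
    rw [Nat.count_succ, ih (by omega), Nat.mod_eq_of_lt (by omega)]
    split_ifs <;> omega

theorem Nat.count_mod_lt_bounds {p m : ℕ} (hm : m ≤ p) (h : ℕ) :
    (h + 1) * m ≤ p * Nat.count (fun e => e % p < m) (h + 1) ∧
      p * Nat.count (fun e => e % p < m) (h + 1) ≤ m * (h + p) := by
  induction h using Nat.strong_induction_on with
  | _ h ih =>
    rcases Nat.lt_or_ge h p with hlt | hge
    · rw [Nat.count_mod_lt_of_le hlt]
      rcases le_total (h + 1) m with h1 | h1
      · rw [min_eq_left h1]
        constructor <;> nlinarith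
      · rw [min_eq_right h1]
        constructor <;> nlinarith
    · rcases Nat.eq_zero_or_pos p with rfl | hp
      · obtain rfl : m = 0 := by omega
        simp
      obtain ⟨d, rfl⟩ := Nat.exists_eq_add_of_le hge
      obtain ⟨h1, h2⟩ := ih d (by omega)
      rw [add_assoc, Nat.count_add, Nat.count_mod_lt_of_le le_rfl, min_eq_right hm]
      simp only [Nat.add_mod_left]
      constructor <;> nlinarith

namespace Polynomial

variable {K : Type*} [Field K]

theorem coeff_eq_zero_of_iterate_derivative_eq_zero {p m e : ℕ} [CharP K p]
    {D : K[X]} (hD : derivative^[m] D = 0) (he : m ≤ e % p) : D.coeff e = 0 := by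
  have hme : m ≤ e := he.trans (Nat.mod_le e p)
  have h := congrArg (fun f : K[X] => f.coeff (e - m)) hD
  simp only [coeff_iterate_derivative, coeff_zero, Nat.sub_add_cancel hme, nsmul_eq_mul,
    mul_eq_zero] at h
  refine h.resolve_left ?_
  rw [Nat.descFactorial_eq_prod_range, Nat.cast_prod, ← ne_eq, Finset.prod_ne_zero_iff]
  intro i hi hz
  have := Finset.mem_range.1 hi
  rw [CharP.cast_eq_zero_iff K p, ← Nat.modEq_iff_dvd' (by omega)] at hz
  have h1 : i % p = e % p := hz
  have := Nat.mod_le i p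
  omega

theorem iterate_derivative_eq_zero_of_coeff {p m : ℕ} [CharP K p]
    {D : K[X]} (hD : ∀ e, m ≤ e % p → D.coeff e = 0) : derivative^[m] D = 0 := by
  ext j
  simp only [coeff_iterate_derivative, coeff_zero, nsmul_eq_mul, mul_eq_zero]
  by_cases hj : m ≤ (j + m) % p
  · exact Or.inr (hD _ hj)
  left
  rw [Nat.descFactorial_eq_prod_range, Nat.cast_prod, Finset.prod_eq_zero_iff]
  refine ⟨(j + m) % p, Finset.mem_range.2 (by omega), ?_⟩
  rw [CharP.cast_eq_zero_iff K p]
  exact Nat.dvd_sub_mod _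

theorem card_mul_le_natDegree_of_irreducible_dvd {R : K[X]} (hR : R ≠ 0) {d : ℕ}
    (T : Finset K[X]) (hT : ∀ P ∈ T, P.Monic ∧ Irreducible P ∧ d ≤ P.natDegree ∧ P ∣ R) :
    T.card * d ≤ R.natDegree := by
  have hdvd : ∏ P ∈ T, P ∣ R := by
    refine Finset.prod_dvd_of_coprime ?_ fun P hP => (hT P hP).2.2.2
    intro P hP Q hQ hne
    refine ((hT P hP).2.1.coprime_iff_not_dvd).2 fun h => hne ?_
    exact eq_of_monic_of_associated (hT P hP).1 (hT Q hQ).1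
      ((hT P hP).2.1.associated_of_dvd (hT Q hQ).2.1 h)
  calc T.card * d ≤ ∑ P ∈ T, P.natDegree := by
        rw [← smul_eq_mul]
        exact Finset.card_nsmul_le_sum _ _ _ fun P hP => (hT P hP).2.2.1
    _ = (∏ P ∈ T, P).natDegree := (natDegree_prod_of_monic _ _ fun P hP => (hT P hP).1).symm
    _ ≤ R.natDegree := natDegree_le_of_dvd hdvd hR

theorem pow_dvd_iterate_derivative {P G : K[X]} {m : ℕ} (h : P ^ (m + 1) ∣ G) :
    P ∣ derivative^[m] G := by
  simpa using pow_sub_dvd_iterate_derivative_of_pow_dvd m h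

theorem exists_monic_irreducible_factor_of_pow_dvd {G : K[X]} {l m : ℕ}
    (h : ∃ P : K[X], Irreducible P ∧ l < P.natDegree ∧ P ^ (m + 1) ∣ G) :
    ∃ P : K[X], P.Monic ∧ Irreducible P ∧ l + 1 ≤ P.natDegree ∧ P ∣ G ∧
      P ∣ derivative^[m] G := by
  classical
  obtain ⟨P, hP, hl, hG⟩ := h
  have ha : Associated (normalize P) P := normalize_associated P
  refine ⟨normalize P, monic_normalize hP.ne_zero, ha.symm.irreducible hP, ?_, ?_, ?_⟩
  · rw [natDegree_eq_of_degree_eq (degree_normalize (p := P))]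
    exact hl
  · exact ha.dvd.trans ((dvd_pow_self P m.succ_ne_zero).trans hG)
  · exact ha.dvd.trans (pow_dvd_iterate_derivative hG)

theorem coeff_eq_of_degree_sub_le {F G H : K[X]} {h e : ℕ}
    (hG : (F - G).degree ≤ (h : WithBot ℕ)) (hH : (F - H).degree ≤ (h : WithBot ℕ))
    (he : h < e) : G.coeff e = H.coeff e := by
  have h1 := coeff_eq_zero_of_degree_lt (hG.trans_lt (Nat.cast_lt.2 he))
  have h2 := coeff_eq_zero_of_degree_lt (hH.trans_lt (Nat.cast_lt.2 he))
  rw [coeff_sub] at h1 h2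
  linear_combination h2 - h1

variable [Fintype K]

theorem finite_setOf_degree_sub_le (F : K[X]) (h : ℕ) :
    {G : K[X] | (F - G).degree ≤ (h : WithBot ℕ)}.Finite := by
  refine Set.Finite.of_finite_image
    (f := fun G : K[X] => fun i : Fin (h + 1) => G.coeff i) (Set.toFinite _) ?_
  intro G hG H hH hGH
  ext e
  rcases Nat.lt_or_ge h e with he | he
  · exact coeff_eq_of_degree_sub_le hG hH he
  · exact congrFun hGH ⟨e, by omega⟩

theorem card_le_pow_of_coeff_injOn (S : Finset K[X]) (A : Finset ℕ)
    (hS : ∀ G ∈ S, ∀ H ∈ S, (∀ e ∈ A, G.coeff e = H.coeff e) → G = H) :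
    S.card ≤ Fintype.card K ^ A.card := by
  classical
  calc S.card ≤ (Finset.univ : Finset (A → K)).card :=
        Finset.card_le_card_of_injOn (fun G e => G.coeff e) (fun _ _ => Finset.mem_univ _)
          fun G hG H hH h => hS G hG H hH fun e he => congrFun h ⟨e, he⟩
    _ = Fintype.card K ^ A.card := by simp

/-- A polynomial in an interval whose `m`-th derivative vanishes is determined by its coefficients
at the exponents with residue less than `m`. -/
theorem card_le_of_iterate_derivative_eq_zero {p m h : ℕ} [CharP K p] {F : K[X]}
    (S : Finset K[X])
    (hS : ∀ G ∈ S, (F - G).degree ≤ (h : WithBot ℕ) ∧ derivative^[m] G = 0) :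
    S.card ≤ Fintype.card K ^ Nat.count (fun e => e % p < m) (h + 1) := by
  rw [Nat.count_eq_card_filter_range]
  refine card_le_pow_of_coeff_injOn S _ fun G hG H hH hGH => ?_
  ext e
  rcases Nat.lt_or_ge h e with he | he
  · exact coeff_eq_of_degree_sub_le (hS G hG).1 (hS H hH).1 he
  by_cases hem : e % p < m
  · exact hGH e (by simp [hem]; omega)
  · have hz := coeff_eq_zero_of_iterate_derivative_eq_zero (p := p) (D := G) (hS G hG).2
      (not_lt.1 hem)
    have hz' := coeff_eq_zero_of_iterate_derivative_eq_zero (p := p) (D := H) (hS H hH).2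
      (not_lt.1 hem)
    rw [hz, hz']

/-- Once the coefficients at exponents with residue at least `m` are fixed, so is the `m`-th
derivative, and each large prime factor of it accounts for at most one polynomial. -/
theorem card_le_of_iterate_derivative_ne_zero {p m h l n : ℕ} [CharP K p] {F : K[X]}
    (hl : h ≤ l) (S : Finset K[X])
    (hS : ∀ G ∈ S, (F - G).degree ≤ (h : WithBot ℕ) ∧ G.natDegree ≤ n ∧
      derivative^[m] G ≠ 0 ∧
        ∃ P : K[X], Irreducible P ∧ l < P.natDegree ∧ P ^ (m + 1) ∣ G) :
    S.card ≤ n / (l + 1) * Fintype.card K ^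
      ((h + 1) - Nat.count (fun e => e % p < m) (h + 1)) := by
  classical
  choose! P hP using fun G (hG : G ∈ S) =>
    exists_monic_irreducible_factor_of_pow_dvd (hS G hG).2.2.2
  set B := (Finset.range (h + 1)).filter (fun e => ¬ e % p < m) with hB
  have hBcard : B.card = (h + 1) - Nat.count (fun e => e % p < m) (h + 1) := by
    have hAB : ((Finset.range (h + 1)).filter (fun e => e % p < m)).card + B.card = h + 1 := by
      rw [hB]
      convert Finset.card_filter_add_card_filter_not (s := Finset.range (h + 1))
        (fun e => e % p < m)
      exact (Finset.card_range _).symm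
    rw [Nat.count_eq_card_filter_range]
    omega
  have key := Finset.card_le_mul_card_image_of_maps_to (s := S)
    (t := (Finset.univ : Finset (B → K))) (f := fun G (e : B) => G.coeff e)
    (fun _ _ => Finset.mem_univ _) (n / (l + 1)) ?_
  · simpa [hBcard] using key
  intro b _
  rcases (S.filter fun G => (fun e : B => G.coeff e) = b).eq_empty_or_nonempty with h0 | ⟨G₀, hG₀⟩
  · simp [h0]
  obtain ⟨hG₀S, hG₀b⟩ := Finset.mem_filter.1 hG₀
  have hder : ∀ G ∈ S.filter fun G => (fun e : B => G.coeff e) = b,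
      derivative^[m] G = derivative^[m] G₀ := by
    intro G hG
    obtain ⟨hGS, hGb⟩ := Finset.mem_filter.1 hG
    rw [← sub_eq_zero, ← iterate_derivative_sub]
    refine iterate_derivative_eq_zero_of_coeff (p := p) fun e he => ?_
    rw [coeff_sub, sub_eq_zero]
    rcases Nat.lt_or_ge h e with he' | he'
    · exact coeff_eq_of_degree_sub_le (hS G hGS).1 (hS G₀ hG₀S).1 he'
    · exact congrFun (hGb.trans hG₀b.symm) ⟨e, by simp [hB, he]; omega⟩
  have hinj : Set.InjOn P (S.filter fun G => (fun e : B => G.coeff e) = b) := by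
    intro G hG H hH hGH
    have hGS := (Finset.mem_filter.1 hG).1
    have hHS := (Finset.mem_filter.1 hH).1
    have hdvd : P G ∣ G - H := dvd_sub (hP G hGS).2.2.2.1 (hGH ▸ (hP H hHS).2.2.2.1)
    rw [← sub_eq_zero]
    refine eq_zero_of_dvd_of_degree_lt hdvd ?_
    have h1 : (G - H).degree ≤ (h : WithBot ℕ) := by
      rw [degree_le_iff_coeff_zero]
      intro e he
      rw [coeff_sub, sub_eq_zero]
      exact coeff_eq_of_degree_sub_le (hS G hGS).1 (hS H hHS).1 (Nat.cast_lt.1 he)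
    refine h1.trans_lt ?_
    rw [degree_eq_natDegree (hP G hGS).2.1.ne_zero, Nat.cast_lt]
    have := (hP G hGS).2.2.1
    omega
  rw [← Finset.card_image_of_injOn hinj, Nat.le_div_iff_mul_le (Nat.succ_pos l)]
  refine (card_mul_le_natDegree_of_irreducible_dvd (hS G₀ hG₀S).2.2.1 _ ?_).trans
    ((natDegree_iterate_derivative _ _).trans ((Nat.sub_le _ _).trans (hS G₀ hG₀S).2.1))
  intro Q hQ
  obtain ⟨G, hG, rfl⟩ := Finset.mem_image.1 hQ
  have hPG := hP G (Finset.mem_filter.1 hG).1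
  exact ⟨hPG.1, hPG.2.1, hPG.2.2.1, hder G hG ▸ hPG.2.2.2.2⟩

end Polynomial


/-- **Bound (4.1).** Let `2 ≤ k < p`, `F` monic of degree `n`, and `0 < h ≤ ℓ < n`.
The number of `G ∈ I_q(F,h)` divisible by `P^k` for some irreducible `P` with
`deg P > ℓ` is at most `(n/(ℓ+1))·q^{(h+1)(1−(k−1)/p)} + q^{(k−1)(h/p+1)}`. -/
theorem sigma3_bound_kfree
    {Fq : Type} [Field Fq] [Fintype Fq] (q p k n h ℓ : ℕ) [CharP Fq p]
    (hq : Fintype.card Fq = q) (hk : 2 ≤ k) (hkp : k < p)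
    (F : Polynomial Fq) (hF : F.Monic) (hFdeg : F.natDegree = n)
    (hh0 : 0 < h) (hhℓ : h ≤ ℓ) (hℓn : ℓ < n) :
    ({G : Polynomial Fq | (F - G).degree ≤ (h : WithBot ℕ) ∧
        ∃ P : Polynomial Fq, Irreducible P ∧ ℓ < P.natDegree ∧ P ^ k ∣ G}.ncard : ℝ)
      ≤ (n : ℝ) / ((ℓ : ℝ) + 1) *
          (q : ℝ) ^ (((h : ℝ) + 1) * (1 - ((k : ℝ) - 1) / (p : ℝ)))
        + (q : ℝ) ^ (((k : ℝ) - 1) * ((h : ℝ) / (p : ℝ) + 1)) := by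
  classical
  obtain ⟨m, rfl⟩ : ∃ m, k = m + 1 := ⟨k - 1, by omega⟩
  set c := Nat.count (fun e => e % p < m) (h + 1) with hc
  obtain ⟨hc1, hc2⟩ := Nat.count_mod_lt_bounds (p := p) (m := m) (by omega) h
  rw [← hc] at hc1 hc2
  have hcle : c ≤ h + 1 := Nat.count_le _
  set S := {G : Polynomial Fq | (F - G).degree ≤ (h : WithBot ℕ) ∧
        ∃ P : Polynomial Fq, Irreducible P ∧ ℓ < P.natDegree ∧ P ^ (m + 1) ∣ G} with hS
  have hfin : S.Finite := (finite_setOf_degree_sub_le F h).subset fun G hG => hG.1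
  have hmem : ∀ G ∈ hfin.toFinset, G ∈ S := fun G hG => hfin.mem_toFinset.1 hG
  have hdeg : ∀ G ∈ S, G.natDegree ≤ n := by
    intro G hG
    rw [natDegree_le_iff_coeff_eq_zero]
    intro e he
    rw [coeff_eq_of_degree_sub_le (h := h) hG.1 (H := F) (by simp) (by omega)]
    exact coeff_eq_zero_of_natDegree_lt (by omega)
  have h0 := card_le_of_iterate_derivative_eq_zero (p := p) (m := m) (h := h) (F := F)
    (hfin.toFinset.filter fun G => derivative^[m] G = 0) fun G hG =>
      ⟨(hmem G (Finset.mem_filter.1 hG).1).1, (Finset.mem_filter.1 hG).2⟩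
  have h1 := card_le_of_iterate_derivative_ne_zero (p := p) (m := m) (n := n) (F := F) hhℓ
    (hfin.toFinset.filter fun G => ¬ derivative^[m] G = 0) fun G hG =>
      ⟨(hmem G (Finset.mem_filter.1 hG).1).1, hdeg G (hmem G (Finset.mem_filter.1 hG).1),
        (Finset.mem_filter.1 hG).2, (hmem G (Finset.mem_filter.1 hG).1).2⟩
  rw [← hc, hq] at h0 h1
  have hcard : S.ncard ≤ n / (ℓ + 1) * q ^ (h + 1 - c) + q ^ c := by
    rw [Set.ncard_eq_toFinset_card S hfin,
      ← Finset.card_filter_add_card_filter_not (fun G : Fq[X] => derivative^[m] G = 0)]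
    omega
  have hp0 : (0 : ℝ) < p := by exact_mod_cast (by omega : 0 < p)
  have hq1 : (1 : ℝ) ≤ q := by
    rw [← hq]
    exact_mod_cast Fintype.card_pos
  have hc1' : ((h : ℝ) + 1) * m ≤ p * c := by exact_mod_cast hc1
  have hc2' : (p : ℝ) * c ≤ m * (h + p) := by exact_mod_cast hc2
  have hdiv : ((n / (ℓ + 1) : ℕ) : ℝ) ≤ (n : ℝ) / ((ℓ : ℝ) + 1) := by
    exact_mod_cast Nat.cast_div_le (α := ℝ) (m := n) (n := ℓ + 1)
  have e1 : (q : ℝ) ^ (h + 1 - c) ≤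
      (q : ℝ) ^ (((h : ℝ) + 1) * (1 - (((m + 1 : ℕ) : ℝ) - 1) / (p : ℝ))) := by
    rw [← Real.rpow_natCast]
    refine Real.rpow_le_rpow_of_exponent_le hq1 ?_
    rw [Nat.cast_sub hcle]
    push_cast
    have : ((h : ℝ) + 1) * m / p ≤ c := by
      rw [div_le_iff₀ hp0]
      linarith
    calc (h : ℝ) + 1 - c ≤ (h + 1) - (h + 1) * m / p := by linarith
      _ = _ := by ring
  have e2 : (q : ℝ) ^ c ≤
      (q : ℝ) ^ ((((m + 1 : ℕ) : ℝ) - 1) * ((h : ℝ) / (p : ℝ) + 1)) := by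
    rw [← Real.rpow_natCast]
    refine Real.rpow_le_rpow_of_exponent_le hq1 ?_
    push_cast
    calc (c : ℝ) ≤ m * (h + p) / p := by
          rw [le_div_iff₀ hp0]
          linarith
      _ = _ := by
          field_simp
          ring
  calc (S.ncard : ℝ) ≤ ((n / (ℓ + 1) : ℕ) : ℝ) * (q : ℝ) ^ (h + 1 - c) + (q : ℝ) ^ c := by
        exact_mod_cast hcard
    _ ≤ _ := by gcongr
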